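/- For all integers n ≥ 2 and r with 1 ≤ r and 2r ≤ n, and every nonnegative integer k, one has C(n,r)·‖Q̃^{*k} − Ũ‖₂² = Σ_{i=1}^{r} [C(n,i) − C(n,i−1)]·(1 − 2i(n−i+1)/n²)^{2k}, where Q̃^{*k} is the probability measure induced on X by the k-fold convolution Q^{*k}. -/

import Mathlib

open scoped Classical Pointwise

noncomputable section

namespace BL

/-- The subgroup of permutations of `Fin n` mapping `{0,…,r−1}` (the "first r positions")
to itself. -/
def blockSubgroup (n r : ℕ) : Subgroup (Equiv.Perm (Fin n)) :=
  MulAction.stabilizer (Equiv.Perm (Fin n)) ({ i : Fin n | (i : ℕ) < r } : Set (Fin n))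

instance fintypeQuot {G : Type*} [Group G] [Fintype G] (H : Subgroup G) : Fintype (G ⧸ H) :=
  Fintype.ofFinite _

/-- Convolution of two (signed) measures on a finite group. -/
def conv {G : Type*} [Group G] [Fintype G] (μ ν : G → ℝ) : G → ℝ :=
  fun g => ∑ h : G, μ h * ν (h⁻¹ * g)

/-- `k`-fold convolution power; `convPow μ 0` is the point mass at the identity. -/
def convPow {G : Type*} [Group G] [Fintype G] (μ : G → ℝ) : ℕ → G → ℝ
  | 0 => fun g => if g = 1 then 1 else 0
  | (k+1) => conv μ (convPow μ k)

/-- The measure induced on the left coset space `G ⧸ H`. -/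
def induced {G : Type*} [Group G] [Fintype G] (H : Subgroup G) (μ : G → ℝ) :
    G ⧸ H → ℝ :=
  fun x => ∑ g : G, if (g : G ⧸ H) = x then μ g else 0

/-- Total variation distance. -/
def tv {X : Type*} [Fintype X] (μ ν : X → ℝ) : ℝ := (1/2) * ∑ x : X, |μ x - ν x|

/-- ℓ² distance. -/
def l2 {X : Type*} [Fintype X] (μ ν : X → ℝ) : ℝ := Real.sqrt (∑ x : X, (μ x - ν x)^2)

/-- Uniform probability measure. -/
def unif (X : Type*) [Fintype X] : X → ℝ := fun _ => 1 / (Fintype.card X)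

/-- `π = τκ` with `τ` a transposition crossing between the two blocks and `κ ∈ K`. -/
def crossProp (n r : ℕ) (π : Equiv.Perm (Fin n)) : Prop :=
  ∃ p q : Fin n, (p : ℕ) < r ∧ r ≤ (q : ℕ) ∧
    ∃ κ ∈ blockSubgroup n r, π = Equiv.swap p q * κ

/-- The Bernoulli–Laplace measure `P`. -/
def P (n r : ℕ) : Equiv.Perm (Fin n) → ℝ := fun π =>
  if crossProp n r π then
    1 / ((r * (n - r) * (Nat.factorial r * Nat.factorial (n - r)) : ℕ) : ℝ)
  else 0

/-- The measure `Q` of the variant model. -/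
def Q (n r : ℕ) : Equiv.Perm (Fin n) → ℝ := fun π =>
  if π ∈ blockSubgroup n r then
    ((n^2 - 2*r*(n-r) : ℕ) : ℝ) / ((n^2 * (Nat.factorial r * Nat.factorial (n - r)) : ℕ) : ℝ)
  else if crossProp n r π then
    2 / ((n^2 * (Nat.factorial r * Nat.factorial (n - r)) : ℕ) : ℝ)
  else 0


open Matrix

section TraceIdentities

variable {A B : Type*} [Fintype A] [Fintype B] [DecidableEq A] [DecidableEq B]

/-- Powers of `l + MN` and `l + NM` have parallel expansions. -/
theorem exists_pow_smul_one_add_mul (l : ℝ) (M : Matrix A B ℝ) (N : Matrix B A ℝ) (m : ℕ) :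
    ∃ R : Matrix B B ℝ, (l • 1 + M * N) ^ m = l ^ m • 1 + M * (R * N) ∧
      (l • 1 + N * M) ^ m = l ^ m • 1 + (R * N) * M := by
  induction m with
  | zero => exact ⟨0, by simp, by simp⟩
  | succ m ih =>
    obtain ⟨R, h1, h2⟩ := ih
    refine ⟨l ^ m • 1 + l • R + R * N * M, ?_, ?_⟩
    · rw [pow_succ, h1]
      simp only [Matrix.add_mul, Matrix.mul_add, Matrix.smul_mul, Matrix.mul_smul, smul_smul,
        Matrix.mul_one, Matrix.one_mul, Matrix.mul_assoc, pow_succ, smul_add]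
      rw [mul_comm (l ^ m) l]
      abel
    · rw [pow_succ, h2]
      simp only [Matrix.add_mul, Matrix.mul_add, Matrix.smul_mul, Matrix.mul_smul, smul_smul,
        Matrix.mul_one, Matrix.one_mul, Matrix.mul_assoc, pow_succ, smul_add]
      rw [mul_comm (l ^ m) l]
      abel

theorem trace_pow_smul_one_add_mul (l : ℝ) (M : Matrix A B ℝ) (N : Matrix B A ℝ) (m : ℕ) :
    trace ((l • 1 + M * N) ^ m) =
      trace ((l • 1 + N * M) ^ m) + ((Fintype.card A : ℝ) - Fintype.card B) * l ^ m := by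
  obtain ⟨R, h1, h2⟩ := exists_pow_smul_one_add_mul l M N m
  rw [h1, h2, trace_add, trace_add, trace_mul_comm M (R * N)]
  simp only [trace_smul, trace_one, smul_eq_mul]
  ring

end TraceIdentities

section Johnson

variable (n : ℕ)

/-- The inclusion matrix between `j`-subsets and `(j+1)`-subsets. -/
def incl (j : ℕ) : Matrix (Set.powersetCard (Fin n) j) (Set.powersetCard (Fin n) (j + 1)) ℝ :=
  fun R S => if (R : Finset (Fin n)) ⊆ S then 1 else 0

/-- The transition matrix of the variant chain on `j`-subsets. -/
def trans (j : ℕ) : Matrix (Set.powersetCard (Fin n) j) (Set.powersetCard (Fin n) j) ℝ :=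
  fun S S' => if S = S' then 1 - 2 * j * (n - j) / (n : ℝ) ^ 2
    else if ((S' : Finset (Fin n)) \ S).card = 1 then 2 / (n : ℝ) ^ 2 else 0

variable {n} {j : ℕ}

theorem sum_powersetCard (f : Finset (Fin n) → ℝ) :
    ∑ S : Set.powersetCard (Fin n) j, f S = ∑ S with S.card = j, f S := by
  refine (Finset.sum_subtype _ (fun S => ?_) f).symm
  simp [Set.powersetCard]

theorem card_union_eq (R R' : Set.powersetCard (Fin n) j) :
    ((R : Finset (Fin n)) ∪ R').card = j + ((R' : Finset (Fin n)) \ R).card := by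
  rw [← Finset.union_sdiff_self_eq_union, Finset.card_union_of_disjoint Finset.disjoint_sdiff,
    Set.powersetCard.card_eq]

theorem card_inter_add (R R' : Set.powersetCard (Fin n) j) :
    ((R : Finset (Fin n)) ∩ R').card + ((R' : Finset (Fin n)) \ R).card = j := by
  rw [Finset.inter_comm, Finset.card_inter_add_card_sdiff, Set.powersetCard.card_eq]

theorem card_sdiff_ne_zero {R R' : Set.powersetCard (Fin n) j} (h : R ≠ R') :
    ((R' : Finset (Fin n)) \ R).card ≠ 0 := by
  intro h0
  rw [Finset.card_eq_zero, Finset.sdiff_eq_empty_iff_subset] at h0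
  exact h (Set.powersetCard.eq_iff_subset.2 h0).symm

theorem card_supersets (R : Finset (Fin n)) (hR : R.card = j) :
    (Finset.univ.filter (fun S : Finset (Fin n) => S.card = j + 1 ∧ R ⊆ S)).card = n - j := by
  have : Finset.univ.filter (fun S : Finset (Fin n) => S.card = j + 1 ∧ R ⊆ S) =
      Rᶜ.image (fun x => insert x R) := by
    ext S
    simp only [Finset.mem_filter, Finset.mem_univ, true_and, Finset.mem_image, Finset.mem_compl]
    constructor
    · rintro ⟨hS, hRS⟩
      have : (S \ R).card = 1 := by rw [Finset.card_sdiff_of_subset hRS]; omega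
      obtain ⟨x, hx⟩ := Finset.card_eq_one.1 this
      refine ⟨x, ?_, ?_⟩
      · have : x ∈ S \ R := by simp [hx]
        exact (Finset.mem_sdiff.1 this).2
      · rw [Finset.insert_eq, ← hx, Finset.sdiff_union_of_subset hRS]
    · rintro ⟨x, hx, rfl⟩
      exact ⟨by rw [Finset.card_insert_of_notMem hx, hR], Finset.subset_insert _ _⟩
  rw [this, Finset.card_image_of_injOn, Finset.card_compl, hR, Fintype.card_fin]
  intro x hx y hy hxy
  have hx' : x ∉ R := by simpa using hx
  have : x ∈ insert y R := by rw [← show insert x R = insert y R from hxy]; simp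
  simpa [hx'] using this

theorem incl_mul_transpose (R R' : Set.powersetCard (Fin n) j) :
    (incl n j * (incl n j)ᵀ) R R' = if R = R' then (n - j : ℝ)
      else if ((R' : Finset (Fin n)) \ R).card = 1 then 1 else 0 := by
  have hsum : (incl n j * (incl n j)ᵀ) R R' = ((Finset.univ.filter (fun S : Finset (Fin n) =>
      S.card = j + 1 ∧ (R : Finset (Fin n)) ∪ R' ⊆ S)).card : ℝ) := by
    simp only [Matrix.mul_apply, Matrix.transpose_apply, incl]
    rw [sum_powersetCard (fun S : Finset (Fin n) => (if (R : Finset (Fin n)) ⊆ S then (1 : ℝ) else 0) *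
      (if (R' : Finset (Fin n)) ⊆ S then 1 else 0)), Finset.card_filter, Finset.sum_filter]
    push_cast
    refine Finset.sum_congr rfl fun S _ => ?_
    simp only [Finset.union_subset_iff]
    split_ifs <;> simp_all
  rw [hsum]
  have hle : j ≤ n := by
    simpa [Set.powersetCard.card_eq] using Finset.card_le_univ (R : Finset (Fin n))
  split_ifs with h h1
  · subst h
    rw [Finset.union_self, card_supersets _ (Set.powersetCard.card_eq R), Nat.cast_sub hle]
  · have hc := card_union_eq R R'
    rw [h1] at hc
    have : Finset.univ.filter (fun S : Finset (Fin n) =>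
      S.card = j + 1 ∧ (R : Finset (Fin n)) ∪ R' ⊆ S) = {(R : Finset (Fin n)) ∪ R'} := by
      ext S
      simp only [Finset.mem_filter, Finset.mem_univ, true_and, Finset.mem_singleton]
      constructor
      · rintro ⟨hS, hs⟩
        exact (Finset.eq_of_subset_of_card_le hs (by omega)).symm
      · rintro rfl
        exact ⟨hc, Finset.Subset.refl _⟩
    simp [this]
  · have hc := card_union_eq R R'
    have h0 := card_sdiff_ne_zero h
    rw [Nat.cast_eq_zero, Finset.card_eq_zero, Finset.filter_eq_empty_iff]
    rintro S - ⟨hS, hs⟩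
    have := Finset.card_le_card hs
    omega

theorem transpose_mul_incl (S S' : Set.powersetCard (Fin n) (j + 1)) :
    ((incl n j)ᵀ * incl n j) S S' = if S = S' then (j + 1 : ℝ)
      else if ((S' : Finset (Fin n)) \ S).card = 1 then 1 else 0 := by
  have hsum : ((incl n j)ᵀ * incl n j) S S' =
      ((Finset.powersetCard j ((S : Finset (Fin n)) ∩ S')).card : ℝ) := by
    simp only [Matrix.mul_apply, Matrix.transpose_apply, incl]
    rw [sum_powersetCard (fun R : Finset (Fin n) => (if R ⊆ (S : Finset (Fin n)) then (1 : ℝ) else 0) *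
      (if R ⊆ (S' : Finset (Fin n)) then 1 else 0))]
    have : Finset.powersetCard j ((S : Finset (Fin n)) ∩ S') = Finset.univ.filter
        (fun R : Finset (Fin n) => R.card = j ∧ R ⊆ S ∧ R ⊆ S') := by
      ext R
      simp [Finset.mem_powersetCard, Finset.subset_inter_iff, and_comm]
    rw [this, Finset.card_filter, Finset.sum_filter]
    push_cast
    refine Finset.sum_congr rfl fun S _ => ?_
    split_ifs <;> simp_all
  have hc := card_inter_add S S'
  rw [hsum, Finset.card_powersetCard]
  split_ifs with h h1
  · subst h
    rw [Finset.inter_self, Set.powersetCard.card_eq]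
    simp
  · rw [show ((S : Finset (Fin n)) ∩ S').card = j by omega]
    simp
  · have h0 := card_sdiff_ne_zero h
    rw [Nat.choose_eq_zero_of_lt (by omega)]
    simp

theorem trans_eq_up (hn : n ≠ 0) : trans n j =
    (1 - 2 * (j + 1) * (n - j) / (n : ℝ) ^ 2) • (1 : Matrix _ _ ℝ) +
      ((2 / (n : ℝ) ^ 2) • incl n j) * (incl n j)ᵀ := by
  have : (n : ℝ) ≠ 0 := Nat.cast_ne_zero.2 hn
  ext S S'
  rw [Matrix.smul_mul, Matrix.add_apply, Matrix.smul_apply, Matrix.smul_apply,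
    incl_mul_transpose, Matrix.one_apply, trans]
  split_ifs <;> simp
  field_simp
  ring

theorem trans_succ_eq_down (hn : n ≠ 0) : trans n (j + 1) =
    (1 - 2 * (j + 1) * (n - j) / (n : ℝ) ^ 2) • (1 : Matrix _ _ ℝ) +
      (incl n j)ᵀ * ((2 / (n : ℝ) ^ 2) • incl n j) := by
  have : (n : ℝ) ≠ 0 := Nat.cast_ne_zero.2 hn
  ext S S'
  rw [Matrix.mul_smul, Matrix.add_apply, Matrix.smul_apply, Matrix.smul_apply,
    transpose_mul_incl, Matrix.one_apply, trans]
  split_ifs <;> simp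
  field_simp
  ring

theorem card_powersetCard_fin : Fintype.card (Set.powersetCard (Fin n) j) = n.choose j := by
  rw [← Nat.card_eq_fintype_card, Set.powersetCard.card, Nat.card_eq_fintype_card,
    Fintype.card_fin]

theorem trace_trans_succ_pow (hn : n ≠ 0) (m : ℕ) :
    trace (trans n (j + 1) ^ m) = trace (trans n j ^ m) +
      ((n.choose (j + 1) : ℝ) - n.choose j) *
        (1 - 2 * (j + 1) * (n - j) / (n : ℝ) ^ 2) ^ m := by
  rw [trans_succ_eq_down hn, trans_eq_up hn, trace_pow_smul_one_add_mul, card_powersetCard_fin,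
    card_powersetCard_fin]

theorem trans_zero : trans n 0 = 1 := by
  have : Subsingleton (Set.powersetCard (Fin n) 0) :=
    Fintype.card_le_one_iff_subsingleton.1 (by rw [card_powersetCard_fin]; simp)
  ext S S'
  obtain rfl := Subsingleton.elim S S'
  simp [trans]

theorem trace_trans_pow (hn : n ≠ 0) (m r : ℕ) :
    trace (trans n r ^ m) = 1 + ∑ i ∈ Finset.Icc 1 r,
      ((n.choose i : ℝ) - n.choose (i - 1)) *
        (1 - 2 * (i : ℝ) * ((n : ℝ) - i + 1) / (n : ℝ) ^ 2) ^ m := by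
  induction r with
  | zero => rw [trans_zero, one_pow, Matrix.trace_one, card_powersetCard_fin]; simp
  | succ r ih =>
    rw [trace_trans_succ_pow hn, ih, Finset.sum_Icc_succ_top (by omega), add_assoc]
    push_cast
    rw [show (n : ℝ) - (r + 1) + 1 = n - r by ring]

theorem trans_isSymm (hn : n ≠ 0) : (trans n j).IsSymm := by
  rw [trans_eq_up hn]
  simp [Matrix.IsSymm, Matrix.transpose_add, Matrix.transpose_mul, Matrix.transpose_smul]

theorem incl_sq (R : Set.powersetCard (Fin n) j) (S : Set.powersetCard (Fin n) (j + 1)) :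
    incl n j R S * incl n j R S = incl n j R S := by
  simp [incl]

theorem incl_mulVec_one : incl n j *ᵥ 1 = (n - j : ℝ) • 1 := by
  ext R
  have := incl_mul_transpose R R
  simp only [Matrix.mul_apply, Matrix.transpose_apply, incl_sq, if_true] at this
  simpa [Matrix.mulVec, dotProduct] using this

theorem incl_transpose_mulVec_one : (incl n j)ᵀ *ᵥ 1 = (j + 1 : ℝ) • 1 := by
  ext S
  have := transpose_mul_incl S S
  simp only [Matrix.mul_apply, Matrix.transpose_apply, incl_sq, if_true] at this
  simpa [Matrix.mulVec, dotProduct] using this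

theorem trans_mulVec_one (hn : n ≠ 0) : trans n j *ᵥ 1 = 1 := by
  rw [trans_eq_up hn, Matrix.add_mulVec, Matrix.smul_mulVec, Matrix.one_mulVec,
    ← Matrix.mulVec_mulVec, incl_transpose_mulVec_one, Matrix.mulVec_smul, Matrix.smul_mulVec,
    incl_mulVec_one]
  ext S
  simp
  ring

theorem trans_pow_mulVec_one (hn : n ≠ 0) (m : ℕ) : trans n j ^ m *ᵥ 1 = 1 := by
  induction m with
  | zero => simp
  | succ m ih => rw [pow_succ, ← Matrix.mulVec_mulVec, trans_mulVec_one hn, ih]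

theorem trans_smul_smul (g : Equiv.Perm (Fin n)) (S S' : Set.powersetCard (Fin n) j) :
    trans n j (g • S) (g • S') = trans n j S S' := by
  simp only [trans, smul_left_cancel_iff, Set.powersetCard.coe_smul,
    ← Finset.smul_finset_sdiff, Finset.card_smul_finset]

theorem trans_pow_smul_smul (m : ℕ) (g : Equiv.Perm (Fin n)) (S S' : Set.powersetCard (Fin n) j) :
    (trans n j ^ m) (g • S) (g • S') = (trans n j ^ m) S S' := by
  induction m generalizing S S' with
  | zero => simp [Matrix.one_apply]
  | succ m ih =>
    rw [pow_succ, Matrix.mul_apply, Matrix.mul_apply,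
      ← Equiv.sum_comp (MulAction.toPerm (β := Set.powersetCard (Fin n) j) g)]
    simp [ih, trans_smul_smul]

theorem trace_trans_pow_eq (m : ℕ) (S : Set.powersetCard (Fin n) j) :
    trace (trans n j ^ m) = n.choose j * (trans n j ^ m) S S := by
  have : ∀ S' : Set.powersetCard (Fin n) j, (trans n j ^ m) S' S' = (trans n j ^ m) S S := by
    intro S'
    have := Set.powersetCard.isPretransitive (α := Fin n) (n := j)
    obtain ⟨g, rfl⟩ := MulAction.exists_smul_eq (Equiv.Perm (Fin n)) S S'
    exact trans_pow_smul_smul m g S S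
  simp only [trace, Matrix.diag_apply, this, Finset.sum_const, Finset.card_univ,
    card_powersetCard_fin, nsmul_eq_mul]

theorem sum_trans_pow_sq (hn : n ≠ 0) (k : ℕ) (S : Set.powersetCard (Fin n) j) :
    ∑ S', (trans n j ^ k) S S' ^ 2 = (trans n j ^ (2 * k)) S S := by
  rw [two_mul, pow_add, Matrix.mul_apply]
  refine Finset.sum_congr rfl fun S' _ => ?_
  have := (trans_isSymm (j := j) hn).pow k
  rw [this.apply S S', sq]

theorem choose_mul_sum_trans_pow_sub_sq (hn : n ≠ 0) (k r : ℕ) (hr : r ≤ n)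
    (S : Set.powersetCard (Fin n) r) :
    (n.choose r : ℝ) * ∑ S', ((trans n r ^ k) S S' - 1 / (n.choose r : ℝ)) ^ 2 =
      trace (trans n r ^ (2 * k)) - 1 := by
  have hc : (n.choose r : ℝ) ≠ 0 := Nat.cast_ne_zero.2 (Nat.choose_pos hr).ne'
  have h1 : ∑ S', (trans n r ^ k) S S' = 1 := by
    simpa [Matrix.mulVec, dotProduct] using congrFun (trans_pow_mulVec_one (j := r) hn k) S
  simp only [sub_sq, Finset.sum_add_distrib, Finset.sum_sub_distrib]
  rw [sum_trans_pow_sq hn, trace_trans_pow_eq _ S, ← Finset.sum_mul, ← Finset.mul_sum, h1]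
  simp only [Finset.sum_const, Finset.card_univ, card_powersetCard_fin, nsmul_eq_mul]
  field_simp
  ring

end Johnson

section Walk

variable {n r : ℕ} {x₀ : Set.powersetCard (Fin n) r}

theorem mem_blockSubgroup_iff (hx : ∀ i, i ∈ (x₀ : Finset (Fin n)) ↔ (i : ℕ) < r)
    (g : Equiv.Perm (Fin n)) : g ∈ blockSubgroup n r ↔ g • x₀ = x₀ := by
  have h : ({i : Fin n | (i : ℕ) < r} : Set (Fin n)) = ((x₀ : Finset (Fin n)) : Set (Fin n)) := by
    ext i
    exact (hx i).symm
  rw [blockSubgroup, h, ← MulAction.mem_stabilizer_iff, Set.powersetCard.stabilizer_coe]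
  rfl

theorem crossProp_iff (hx : ∀ i, i ∈ (x₀ : Finset (Fin n)) ↔ (i : ℕ) < r)
    (g : Equiv.Perm (Fin n)) :
    crossProp n r g ↔ (((g • x₀ : Set.powersetCard (Fin n) r) : Finset (Fin n)) \ x₀).card = 1 := by
  constructor
  · rintro ⟨p, q, hp, hq, κ, hκ, rfl⟩
    rw [mem_blockSubgroup_iff hx] at hκ
    rw [mul_smul, hκ, Finset.card_eq_one]
    refine ⟨q, ?_⟩
    have hpq : p ≠ q := by rintro rfl; omega
    ext a
    rw [Finset.mem_sdiff, Set.powersetCard.coe_smul, ← Finset.inv_smul_mem_iff, hx, hx,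
      Equiv.swap_inv, Equiv.Perm.smul_def, Finset.mem_singleton]
    rcases eq_or_ne a p with rfl | h1
    · rw [Equiv.swap_apply_left]
      constructor
      · intro h; omega
      · intro h; exact absurd h hpq
    rcases eq_or_ne a q with rfl | h2
    · rw [Equiv.swap_apply_right]
      simp; omega
    · rw [Equiv.swap_apply_of_ne_of_ne h1 h2]
      simp [h2]
  · intro h
    set y := g • x₀ with hy
    obtain ⟨q, hq⟩ := Finset.card_eq_one.1 h
    rw [Finset.card_sdiff_comm (by simp [Set.powersetCard.card_eq])] at h
    obtain ⟨p, hp⟩ := Finset.card_eq_one.1 h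
    have hq' : ∀ a, (a ∈ (y : Finset (Fin n)) ∧ a ∉ (x₀ : Finset (Fin n))) ↔ a = q := by
      intro a; rw [← Finset.mem_sdiff, hq, Finset.mem_singleton]
    have hp' : ∀ a, (a ∈ (x₀ : Finset (Fin n)) ∧ a ∉ (y : Finset (Fin n))) ↔ a = p := by
      intro a; rw [← Finset.mem_sdiff, hp, Finset.mem_singleton]
    have hqm := (hq' q).2 rfl
    have hpm := (hp' p).2 rfl
    refine ⟨p, q, (hx p).1 hpm.1, not_lt.1 fun h => hqm.2 ((hx q).2 h), Equiv.swap p q * g, ?_,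
      by rw [← mul_assoc, Equiv.swap_mul_self, one_mul]⟩
    rw [mem_blockSubgroup_iff hx, mul_smul, ← hy]
    apply Subtype.ext
    ext a
    rw [Set.powersetCard.coe_smul, ← Finset.inv_smul_mem_iff, Equiv.swap_inv, Equiv.Perm.smul_def]
    rcases eq_or_ne a p with rfl | h1
    · rw [Equiv.swap_apply_left]
      exact iff_of_true hqm.1 hpm.1
    rcases eq_or_ne a q with rfl | h2
    · rw [Equiv.swap_apply_right]
      exact iff_of_false hpm.2 hqm.2
    · rw [Equiv.swap_apply_of_ne_of_ne h1 h2]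
      have := hq' a
      have := hp' a
      tauto

theorem card_fiber (hr : r ≤ n) (y : Set.powersetCard (Fin n) r) :
    (Finset.univ.filter (fun g : Equiv.Perm (Fin n) => g • x₀ = y)).card =
      Nat.factorial r * Nat.factorial (n - r) := by
  have htr := Set.powersetCard.isPretransitive (α := Fin n) (n := r)
  have hconst : ∀ z : Set.powersetCard (Fin n) r,
      (Finset.univ.filter (fun g : Equiv.Perm (Fin n) => g • x₀ = z)).card =
      (Finset.univ.filter (fun g : Equiv.Perm (Fin n) => g • x₀ = y)).card := by
    intro z
    obtain ⟨h, rfl⟩ := MulAction.exists_smul_eq (Equiv.Perm (Fin n)) y z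
    refine Finset.card_bij (fun g _ => h⁻¹ * g) ?_ ?_ ?_
    · intro g hg
      simp only [Finset.mem_filter, Finset.mem_univ, true_and] at hg ⊢
      rw [mul_smul, hg, inv_smul_smul]
    · intro a _ b _ hab
      exact mul_left_cancel hab
    · intro g hg
      simp only [Finset.mem_filter, Finset.mem_univ, true_and] at hg
      exact ⟨h * g, by simp [mul_smul, hg], by simp⟩
  have hsum := Finset.card_eq_sum_card_fiberwise (s := Finset.univ) (t := Finset.univ)
    (f := fun g : Equiv.Perm (Fin n) => g • x₀) (fun _ _ => Finset.mem_coe.2 (Finset.mem_univ _))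
  rw [Finset.sum_congr rfl (fun z _ => hconst z), Finset.sum_const, Finset.card_univ,
    Finset.card_univ, Fintype.card_perm, Fintype.card_fin, card_powersetCard_fin, smul_eq_mul,
    ← Nat.choose_mul_factorial_mul_factorial hr, mul_assoc] at hsum
  exact (Nat.eq_of_mul_eq_mul_left (Nat.choose_pos hr) hsum).symm

theorem sum_Q_fiber (hn : n ≠ 0) (hr : r ≤ n)
    (hx : ∀ i, i ∈ (x₀ : Finset (Fin n)) ↔ (i : ℕ) < r) (y : Set.powersetCard (Fin n) r) :
    ∑ g : Equiv.Perm (Fin n), (if g • x₀ = y then Q n r g else 0) = trans n r x₀ y := by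
  have hn' : (n : ℝ) ≠ 0 := Nat.cast_ne_zero.2 hn
  have hf : ((Nat.factorial r * Nat.factorial (n - r) : ℕ) : ℝ) ≠ 0 :=
    Nat.cast_ne_zero.2 (mul_ne_zero (Nat.factorial_ne_zero _) (Nat.factorial_ne_zero _))
  have hQ : ∀ g : Equiv.Perm (Fin n), (if g • x₀ = y then Q n r g else 0) =
      if g • x₀ = y then
        trans n r x₀ y / ((Nat.factorial r * Nat.factorial (n - r) : ℕ) : ℝ) else 0 := by
    intro g
    split_ifs with h
    · subst h
      rw [Q, trans]
      simp only [mem_blockSubgroup_iff hx, crossProp_iff hx, eq_comm (a := x₀)]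
      have hle : 2 * r * (n - r) ≤ n ^ 2 := by
        obtain ⟨d, rfl⟩ := Nat.exists_eq_add_of_le hr
        rw [Nat.add_sub_cancel_left]
        nlinarith [sq_nonneg (r : ℤ), sq_nonneg (d : ℤ)]
      rw [Nat.cast_mul (n ^ 2), Nat.cast_sub hle]
      generalize ((Nat.factorial r * Nat.factorial (n - r) : ℕ) : ℝ) = F at hf
      push_cast [Nat.cast_sub hr]
      split_ifs
      · field_simp
      · field_simp
      · simp
    · rfl
  rw [Finset.sum_congr rfl fun g _ => hQ g, ← Finset.sum_filter, Finset.sum_const,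
    card_fiber hr, nsmul_eq_mul]
  field_simp

theorem sum_convPow_fiber (hn : n ≠ 0) (hr : r ≤ n)
    (hx : ∀ i, i ∈ (x₀ : Finset (Fin n)) ↔ (i : ℕ) < r) (k : ℕ)
    (y : Set.powersetCard (Fin n) r) :
    ∑ g : Equiv.Perm (Fin n), (if g • x₀ = y then convPow (Q n r) k g else 0) =
      (trans n r ^ k) x₀ y := by
  induction k generalizing y with
  | zero =>
    rw [Finset.sum_eq_single 1 (by simp +contextual [convPow]) (by simp)]
    simp [convPow, Matrix.one_apply]
  | succ k ih =>
    have hshift : ∀ h : Equiv.Perm (Fin n),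
        ∑ g : Equiv.Perm (Fin n), (if g • x₀ = y then convPow (Q n r) k (h⁻¹ * g) else 0) =
          (trans n r ^ k) (h • x₀) y := by
      intro h
      rw [← Equiv.sum_comp (Equiv.mulLeft h)]
      simp only [Equiv.coe_mulLeft, inv_mul_cancel_left, mul_smul]
      rw [← smul_inv_smul h y, trans_pow_smul_smul, ← ih]
      simp only [smul_left_cancel_iff]
    calc _ = ∑ g : Equiv.Perm (Fin n), ∑ h : Equiv.Perm (Fin n), Q n r h *
          (if g • x₀ = y then convPow (Q n r) k (h⁻¹ * g) else 0) := by
          refine Finset.sum_congr rfl fun g _ => ?_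
          split_ifs <;> simp [convPow, conv]
      _ = ∑ h : Equiv.Perm (Fin n), Q n r h * (trans n r ^ k) (h • x₀) y := by
          rw [Finset.sum_comm]
          simp only [← Finset.mul_sum, hshift]
      _ = ∑ h : Equiv.Perm (Fin n), ∑ z : Set.powersetCard (Fin n) r,
          (if h • x₀ = z then Q n r h else 0) * (trans n r ^ k) z y := by
          simp [ite_mul]
      _ = (trans n r ^ (k + 1)) x₀ y := by
          rw [Finset.sum_comm, pow_succ', Matrix.mul_apply]
          simp only [← Finset.sum_mul, sum_Q_fiber hn hr hx]

/-- Cosets of the block subgroup correspond to `r`-subsets. -/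
theorem exists_quotient_equiv (hx : ∀ i, i ∈ (x₀ : Finset (Fin n)) ↔ (i : ℕ) < r) :
    ∃ e : Equiv.Perm (Fin n) ⧸ blockSubgroup n r ≃ Set.powersetCard (Fin n) r,
      ∀ g : Equiv.Perm (Fin n), e g = g • x₀ := by
  have htr := Set.powersetCard.isPretransitive (α := Fin n) (n := r)
  have hiff : ∀ a b : Equiv.Perm (Fin n),
      (a : Equiv.Perm (Fin n) ⧸ blockSubgroup n r) = b ↔ a • x₀ = b • x₀ := by
    intro a b
    rw [QuotientGroup.eq, mem_blockSubgroup_iff hx, mul_smul, inv_smul_eq_iff, eq_comm]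
  let f : Equiv.Perm (Fin n) ⧸ blockSubgroup n r → Set.powersetCard (Fin n) r :=
    fun q => q.out • x₀
  have hf : ∀ g : Equiv.Perm (Fin n), f g = g • x₀ := fun g =>
    (hiff _ _).1 (QuotientGroup.out_eq' _)
  refine ⟨Equiv.ofBijective f ⟨?_, ?_⟩, hf⟩
  · intro a b
    induction a using QuotientGroup.induction_on
    induction b using QuotientGroup.induction_on
    rw [hf, hf]
    exact (hiff _ _).2
  · intro y
    obtain ⟨g, hg⟩ := MulAction.exists_smul_eq (Equiv.Perm (Fin n)) x₀ y
    exact ⟨g, (hf g).trans hg⟩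

end Walk

/-- the exact ℓ² formula for the variant model,
`C(n,r)·‖Q̃^{*k} − Ũ‖₂² = Σ_{i=1}^{r} [C(n,i) − C(n,i−1)]·(1 − 2i(n−i+1)/n²)^{2k}`. -/
theorem variant_l2_formula (n r : ℕ) (hn : 2 ≤ n) (hr : 1 ≤ r)
    (hrn : 2 * r ≤ n) (k : ℕ) :
    (n.choose r : ℝ) *
      (l2 (induced (blockSubgroup n r) (convPow (Q n r) k))
          (unif (Equiv.Perm (Fin n) ⧸ blockSubgroup n r)))^2 =
    ∑ i ∈ Finset.Icc 1 r,
      ((n.choose i : ℝ) - (n.choose (i-1) : ℝ)) *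
        (1 - (2 * (i : ℝ) * ((n : ℝ) - i + 1)) / ((n : ℝ)^2))^(2*k) := by
  have hn0 : n ≠ 0 := by omega
  have hrn' : r ≤ n := by omega
  have hcard : (Finset.univ.filter (fun i : Fin n => (i : ℕ) < r)).card = r := by
    rw [Fin.card_filter_val_lt, min_eq_right hrn']
  let x₀ : Set.powersetCard (Fin n) r := ⟨_, hcard⟩
  have hx : ∀ i, i ∈ (x₀ : Finset (Fin n)) ↔ (i : ℕ) < r := fun i => by simp [x₀]
  obtain ⟨e, he⟩ := exists_quotient_equiv hx
  have hind : ∀ q, induced (blockSubgroup n r) (convPow (Q n r) k) q =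
      (trans n r ^ k) x₀ (e q) := by
    intro q
    rw [← sum_convPow_fiber hn0 hrn' hx]
    refine Finset.sum_congr rfl fun g _ => ?_
    simp only [← he, e.apply_eq_iff_eq]
  rw [l2, Real.sq_sqrt (Finset.sum_nonneg fun _ _ => sq_nonneg _)]
  simp only [hind, unif, Fintype.card_congr e, card_powersetCard_fin]
  rw [e.sum_comp (fun y => ((trans n r ^ k) x₀ y - 1 / (n.choose r : ℝ)) ^ 2),
    choose_mul_sum_trans_pow_sub_sq hn0 k r hrn' x₀, trace_trans_pow hn0, add_sub_cancel_left]

end BL
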